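/- The group of Lie algebra automorphisms of D_n = Der_K(P_n) is canonically isomorphic to the group Aut_K(P_n) of K-algebra automorphisms of P_n: the map Aut_K(P_n) → Aut_Lie(D_n), σ ↦ (δ ↦ σδσ^{-1}), is a group isomorphism. -/

import Mathlib

open MvPolynomial

variable {n : ℕ} {K : Type*} [Field K] [CharZero K]

/-- Conjugation of a derivation of P_n by a K-algebra automorphism: δ ↦ σ δ σ⁻¹. -/
noncomputable def conjDer (σ : MvPolynomial (Fin n) K ≃ₐ[K] MvPolynomial (Fin n) K)
    (δ : Derivation K (MvPolynomial (Fin n) K) (MvPolynomial (Fin n) K)) :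
    Derivation K (MvPolynomial (Fin n) K) (MvPolynomial (Fin n) K) where
  toLinearMap := σ.toLinearMap ∘ₗ δ.toLinearMap ∘ₗ σ.symm.toLinearMap
  map_one_eq_zero' := by simp
  leibniz' a b := by
    simp only [LinearMap.coe_comp, Function.comp_apply, AlgEquiv.toLinearMap_apply, Derivation.coeFn_coe, map_mul]
    rw [Derivation.leibniz]
    simp only [smul_eq_mul, map_add, map_mul, AlgEquiv.apply_symm_apply]

set_option linter.unusedSectionVars false in
@[simp] lemma conjDer_apply (σ : MvPolynomial (Fin n) K ≃ₐ[K] MvPolynomial (Fin n) K)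
    (δ : Derivation K (MvPolynomial (Fin n) K) (MvPolynomial (Fin n) K))
    (p : MvPolynomial (Fin n) K) :
    conjDer σ δ p = σ (δ (σ.symm p)) := rfl

/-- Conjugation by σ ∈ Aut_K(P_n) as a Lie algebra automorphism of D_n = Der_K(P_n). -/
noncomputable def conjLie (σ : MvPolynomial (Fin n) K ≃ₐ[K] MvPolynomial (Fin n) K) :
    Derivation K (MvPolynomial (Fin n) K) (MvPolynomial (Fin n) K) ≃ₗ⁅K⁆
    Derivation K (MvPolynomial (Fin n) K) (MvPolynomial (Fin n) K) where
  toFun := conjDer σ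
  map_add' δ₁ δ₂ := by ext p; simp
  map_smul' c δ := by ext p; simp
  map_lie' {δ₁ δ₂} := by
    ext p
    simp [Derivation.commutator_apply, map_sub]
  invFun := conjDer σ.symm
  left_inv δ := by ext p; simp
  right_inv δ := by ext p; simp

abbrev PolyN (n : ℕ) (K : Type*) [Field K] := MvPolynomial (Fin n) K

abbrev DerN (n : ℕ) (K : Type*) [Field K] := Derivation K (PolyN n K) (PolyN n K)

section aux

set_option linter.unusedSectionVars false

lemma der_lie_smul (D F : DerN n K) (a : PolyN n K) :
    ⁅D, a • F⁆ = D a • F + a • ⁅D, F⁆ := by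
  refine Derivation.ext fun p => ?_
  simp only [Derivation.commutator_apply, Derivation.smul_apply, Derivation.add_apply,
    smul_eq_mul, Derivation.leibniz]
  ring

lemma der_sum_apply (F : Fin n → DerN n K) (p : PolyN n K) : (∑ i, F i) p = ∑ i, F i p := by
  change Derivation.coeFnAddMonoidHom (∑ i, F i) p = _
  rw [map_sum, Finset.sum_apply]
  rfl

lemma der_lie_sub (D F G : DerN n K) : ⁅D, F - G⁆ = ⁅D, F⁆ - ⁅D, G⁆ := by
  refine Derivation.ext fun p => ?_
  simp only [Derivation.commutator_apply, Derivation.sub_apply, map_sub]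
  ring

lemma der_lie_sum (D : DerN n K) (F : Fin n → DerN n K) : ⁅D, ∑ i, F i⁆ = ∑ i, ⁅D, F i⁆ := by
  refine Derivation.ext fun p => ?_
  simp only [Derivation.commutator_apply, der_sum_apply, map_sum, Finset.sum_sub_distrib]

lemma der_C_smul (c : K) (E : DerN n K) : (C c : PolyN n K) • E = c • E := by
  refine Derivation.ext fun p => ?_
  simp [smul_eq_C_mul]

lemma der_lie_smul_const (D F : DerN n K) (c : K) : ⁅D, c • F⁆ = c • ⁅D, F⁆ := by
  rw [← der_C_smul, der_lie_smul, derivation_C, zero_smul, zero_add, der_C_smul]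

lemma lieEquiv_inj (φ : DerN n K ≃ₗ⁅K⁆ DerN n K) {D E : DerN n K} (h : φ D = φ E) : D = E :=
  φ.injective h

lemma der_smul_eq_zero {D : DerN n K} {a : PolyN n K} (hD : D ≠ 0) (h : a • D = 0) : a = 0 := by
  by_contra ha
  apply hD
  apply derivation_ext
  intro p
  have := congrArg (fun E : DerN n K => E (X p)) h
  simpa [ha] using this

lemma pderiv_lie_pderiv (i j : Fin n) : ⁅(pderiv i : DerN n K), (pderiv j : DerN n K)⁆ = 0 := by
  apply derivation_ext
  intro k
  rw [Derivation.commutator_apply]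
  simp only [pderiv_X, Pi.single_apply]
  split_ifs <;> simp

lemma pderiv_der_ne_zero (i : Fin n) : (pderiv i : DerN n K) ≠ 0 := by
  intro h
  have := congrArg (fun E : DerN n K => E (X i)) h
  simp at this

lemma der_eq_sum (D : DerN n K) : D = ∑ i, D (X i) • (pderiv i : DerN n K) := by
  apply derivation_ext
  intro k
  simp [der_sum_apply, pderiv_X, Pi.single_apply]

/-- killed by all words of length k in the operators `T i` -/
def KilledBy {M : Type*} [Zero M] (T : Fin n → M → M) : ℕ → M → Prop
  | 0, f => f = 0
  | (k + 1), f => ∀ i, KilledBy T k (T i f)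

lemma killed_ex (D : DerN n K) :
    ∃ k, KilledBy (fun i (E : DerN n K) => ⁅(pderiv i : DerN n K), E⁆) k D := by
  have key : ∀ (k : ℕ) (E : DerN n K), (∀ i m, k ≤ m.degree → coeff m (E (X i)) = 0) →
      KilledBy (fun i (E : DerN n K) => ⁅(pderiv i : DerN n K), E⁆) k E := by
    intro k
    induction k with
    | zero =>
      intro E h
      apply derivation_ext
      intro i
      ext m
      simp [h i m]
    | succ k ih =>
      intro E h j
      apply ih
      intro i m hm
      have : E (pderiv j (X i)) = 0 := by
        simp only [pderiv_X, Pi.single_apply]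
        split_ifs <;> simp
      simp only [Derivation.commutator_apply, this, sub_zero, coeff_pderiv]
      rw [h, zero_mul]
      simp [hm]
  refine ⟨(Finset.univ.sup fun i => (D (X i)).totalDegree) + 1, key _ _ ?_⟩
  intro i m hm
  apply coeff_eq_zero_of_totalDegree_lt
  have := Finset.le_sup (f := fun i => (D (X i)).totalDegree) (Finset.mem_univ i)
  have h2 : m.degree = ∑ i ∈ m.support, m i := rfl
  omega

end aux

lemma const_of_pderiv (f : PolyN n K) (h : ∀ i, pderiv i f = 0) : f = C (coeff 0 f) := by
  ext m
  rw [coeff_C]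
  split_ifs with hm
  · rw [hm]
  · obtain ⟨i, hi⟩ : ∃ i, m i ≠ 0 := by
      by_contra hc
      push Not at hc
      exact hm (by ext i; simp [hc i])
    have h1 := congrArg (coeff (m - Finsupp.single i 1)) (h i)
    rw [coeff_pderiv, tsub_add_cancel_of_le (by simpa [Nat.one_le_iff_ne_zero] using hi)] at h1
    rw [coeff_zero, mul_eq_zero] at h1
    rcases h1 with h1 | h1
    · exact h1
    · exact absurd h1 (Nat.cast_add_one_ne_zero _)

lemma centralizer (D : DerN n K) (h : ∀ i, ⁅(pderiv i : DerN n K), D⁆ = 0) :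
    ∃ c : Fin n → K, D = ∑ i, c i • (pderiv i : DerN n K) := by
  refine ⟨fun i => coeff 0 (D (X i)), ?_⟩
  conv_lhs => rw [der_eq_sum D]
  refine Finset.sum_congr rfl fun i _ => ?_
  rw [const_of_pderiv (D (X i)) ?_]
  · rw [der_C_smul]
  · intro k
    have h1 := congrArg (fun E : DerN n K => E (X i)) (h k)
    have : D (pderiv k (X i)) = 0 := by
      simp only [pderiv_X, Pi.single_apply]
      split_ifs <;> simp
    simpa only [Derivation.commutator_apply, this, sub_zero, Derivation.zero_apply] using h1

section main

variable (φ : DerN n K ≃ₗ⁅K⁆ DerN n K)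

/-- images of the partial derivatives -/
noncomputable def dd (i : Fin n) : DerN n K := φ (pderiv i)

lemma dd_ne (i : Fin n) : dd φ i ≠ 0 := by
  intro h
  exact pderiv_der_ne_zero (K := K) i (lieEquiv_inj φ (by rw [map_zero]; exact h))

lemma dd_comm (i j : Fin n) : ⁅dd φ i, dd φ j⁆ = 0 := by
  rw [dd, dd, ← LieEquiv.map_lie, pderiv_lie_pderiv, map_zero]

lemma dd_comm_apply (i j : Fin n) (f : PolyN n K) : dd φ i (dd φ j f) = dd φ j (dd φ i f) := by
  have := congrArg (fun E : DerN n K => E f) (dd_comm φ i j)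
  simpa [Derivation.commutator_apply, sub_eq_zero] using this

lemma dd_centralizer (D : DerN n K) (h : ∀ i, ⁅dd φ i, D⁆ = 0) :
    ∃ c : Fin n → K, D = ∑ i, c i • dd φ i := by
  obtain ⟨c, hc⟩ := centralizer (φ.symm D) (by
    intro i
    apply lieEquiv_inj φ
    rw [LieEquiv.map_lie, LieEquiv.apply_symm_apply, map_zero]
    exact h i)
  refine ⟨c, ?_⟩
  have := congrArg φ hc
  rw [LieEquiv.apply_symm_apply] at this
  rw [this]
  simp [dd]

lemma dd_const (i₀ : Fin n) (a : PolyN n K) (h : ∀ i, dd φ i a = 0) : ∃ c : K, a = C c := by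
  by_cases ha : a = 0
  · exact ⟨0, by simp [ha]⟩
  obtain ⟨j, hj⟩ : ∃ j, dd φ i₀ (X j) ≠ 0 := by
    by_contra hc
    push Not at hc
    exact dd_ne φ i₀ (derivation_ext (by simpa using hc))
  set B := Finset.univ.sup fun i => (dd φ i (X j)).totalDegree with hB
  have hpow : ∀ m : ℕ, (a ^ m * dd φ i₀ (X j)).totalDegree ≤ B := by
    intro m
    obtain ⟨c, hc⟩ := dd_centralizer φ (a ^ m • dd φ i₀) (by
      intro i
      rw [der_lie_smul, dd_comm, Derivation.leibniz_pow, h i]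
      simp)
    have h1 := congrArg (fun E : DerN n K => E (X j)) hc
    simp only [Derivation.smul_apply, smul_eq_mul, der_sum_apply] at h1
    rw [h1]
    refine totalDegree_finsetSum_le fun i _ => ?_
    refine (totalDegree_smul_le _ _).trans ?_
    exact Finset.le_sup (f := fun i => (dd φ i (X j)).totalDegree) (Finset.mem_univ i)
  have hp : ∀ m : ℕ, (a ^ m).totalDegree = m * a.totalDegree := by
    intro m
    induction m with
    | zero => simp
    | succ m ih =>
      rw [pow_succ, totalDegree_mul_of_isDomain (pow_ne_zero _ ha) ha, ih]; ring
  have h2 := hpow (B + 1)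
  rw [totalDegree_mul_of_isDomain (pow_ne_zero _ ha) hj, hp] at h2
  have h3 : a.totalDegree = 0 := by
    by_contra h0
    have : B + 1 ≤ (B + 1) * a.totalDegree := Nat.le_mul_of_pos_right _ (Nat.pos_of_ne_zero h0)
    omega
  exact ⟨_, totalDegree_eq_zero_iff_eq_C.mp h3⟩

lemma dd_killed_der (D : DerN n K) :
    ∃ k, KilledBy (fun i (E : DerN n K) => ⁅dd φ i, E⁆) k D := by
  obtain ⟨k, hk⟩ := killed_ex (φ.symm D)
  refine ⟨k, ?_⟩
  have key : ∀ (k : ℕ) (E : DerN n K),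
      KilledBy (fun i (E : DerN n K) => ⁅(pderiv i : DerN n K), E⁆) k E →
      KilledBy (fun i (E : DerN n K) => ⁅dd φ i, E⁆) k (φ E) := by
    intro k
    induction k with
    | zero =>
      intro E h
      change E = 0 at h
      change φ E = 0
      rw [h, map_zero]
    | succ k ih =>
      intro E h i
      have := ih _ (h i)
      rw [LieEquiv.map_lie] at this
      exact this
  simpa using key k _ hk

lemma dd_killed (i₀ : Fin n) (f : PolyN n K) :
    ∃ k, KilledBy (fun i (g : PolyN n K) => dd φ i g) k f := by
  obtain ⟨k, hk⟩ := dd_killed_der φ (f • dd φ i₀)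
  refine ⟨k, ?_⟩
  induction k generalizing f with
  | zero => exact der_smul_eq_zero (dd_ne φ i₀) hk
  | succ k ih =>
    intro i
    apply ih
    have := hk i
    simpa only [der_lie_smul, dd_comm, smul_zero, add_zero] using this

/-- existence of a nonconstant `f` all of whose `dd` derivatives are constant -/
lemma exists_slice (i₀ : Fin n) : ∃ (f : PolyN n K) (c : Fin n → K) (j : Fin n),
    (∀ i, dd φ i f = C (c i)) ∧ c j ≠ 0 := by
  have key : ∀ (k : ℕ) (f : PolyN n K), KilledBy (fun i (g : PolyN n K) => dd φ i g) k f →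
      (¬ ∃ c, f = C c) → ∃ (f : PolyN n K) (c : Fin n → K) (j : Fin n),
      (∀ i, dd φ i f = C (c i)) ∧ c j ≠ 0 := by
    intro k
    induction k with
    | zero => intro f h hf; exact absurd ⟨0, by simpa using (show f = 0 from h)⟩ hf
    | succ k ih =>
      intro f h hf
      by_cases hall : ∀ i, ∃ c, dd φ i f = C c
      · choose c hc using hall
        by_cases h0 : ∀ j, c j = 0
        · exact absurd (dd_const φ i₀ f (by simpa [h0] using hc)) hf
        · push Not at h0
          obtain ⟨j, hj⟩ := h0
          exact ⟨f, c, j, hc, hj⟩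
      · push Not at hall
        obtain ⟨i, hi⟩ := hall
        exact ih _ (h i) (by push Not; exact hi)
  obtain ⟨k, hk⟩ := dd_killed φ i₀ (X i₀)
  refine key k _ hk ?_
  rintro ⟨c, hc⟩
  have := congrArg (pderiv i₀) hc
  simp at this

lemma lie_pderiv_X (k i j : Fin n) :
    ⁅(pderiv k : DerN n K), (X i : PolyN n K) • (pderiv j : DerN n K)⁆ =
      if i = k then (pderiv j : DerN n K) else 0 := by
  rw [der_lie_smul, pderiv_lie_pderiv, pderiv_X, Pi.single_apply]
  split_ifs <;> simp

lemma exists_coords (i₀ : Fin n) : ∃ x : Fin n → PolyN n K,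
    ∀ k i, dd φ k (x i) = if i = k then 1 else 0 := by
  obtain ⟨f, c, j, hc, hj⟩ := exists_slice φ i₀
  refine ⟨fun i => C (c j)⁻¹ * φ ((X i : PolyN n K) • (pderiv j : DerN n K)) f, ?_⟩
  intro k i
  have h1 := congrArg (fun E => (φ E) f) (lie_pderiv_X (K := K) k i j)
  simp only [LieEquiv.map_lie, Derivation.commutator_apply] at h1
  change dd φ k _ - (φ ((X i : PolyN n K) • (pderiv j : DerN n K))) (dd φ k f) = _ at h1
  rw [hc k, derivation_C, sub_zero] at h1
  change dd φ k (C (c j)⁻¹ * (φ ((X i : PolyN n K) • (pderiv j : DerN n K))) f) = _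
  rw [← smul_eq_C_mul, Derivation.map_smul, h1]
  split_ifs
  · change _ • dd φ j f = _
    rw [hc j, smul_eq_C_mul, ← C_mul, inv_mul_cancel₀ hj, C_1]
  · simp

/-- The Euler derivation -/
noncomputable def eul : DerN n K := ∑ i, (X i : PolyN n K) • (pderiv i : DerN n K)

lemma lie_pderiv_eul (k : Fin n) : ⁅(pderiv k : DerN n K), (eul : DerN n K)⁆ = pderiv k := by
  rw [eul, der_lie_sum]
  simp [lie_pderiv_X]

lemma exists_coords' (i₀ : Fin n) : ∃ x : Fin n → PolyN n K,
    (∀ k i, dd φ k (x i) = if i = k then 1 else 0) ∧ φ eul = ∑ i, x i • dd φ i := by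
  obtain ⟨x, hx⟩ := exists_coords φ i₀
  obtain ⟨c, hc⟩ := dd_centralizer φ (φ eul - ∑ i, x i • dd φ i) (by
    intro k
    rw [der_lie_sub, der_lie_sum]
    simp only [der_lie_smul, dd_comm, hx]
    have := congrArg φ (lie_pderiv_eul (K := K) k)
    rw [LieEquiv.map_lie] at this
    change ⁅dd φ k, _⁆ = dd φ k at this
    rw [this]
    simp)
  refine ⟨fun i => x i + C (c i), ?_, ?_⟩
  · intro k i
    rw [map_add, derivation_C, hx, add_zero]
  · rw [sub_eq_iff_eq_add] at hc
    rw [hc, ← Finset.sum_add_distrib]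
    refine Finset.sum_congr rfl fun i _ => ?_
    rw [add_smul, der_C_smul, add_comm]

lemma intertwine (x : Fin n → PolyN n K)
    (hx : ∀ k i, dd φ k (x i) = if i = k then 1 else 0) (k : Fin n) (g : PolyN n K) :
    dd φ k (aeval x g) = aeval x (pderiv k g) := by
  induction g using MvPolynomial.induction_on with
  | C a => simp [← algebraMap_eq]
  | add p q hp hq => simp only [map_add, hp, hq]
  | mul_X p i hp =>
    simp only [map_mul, aeval_X, Derivation.leibniz, smul_eq_mul, hp, hx, pderiv_X,
      Pi.single_apply, map_add]
    split_ifs <;> simp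

lemma eul_hom {d : ℕ} {g : PolyN n K} (hg : g.IsHomogeneous d) : (eul : DerN n K) g = (d : K) • g := by
  have := hg.sum_X_mul_pderiv
  simp only [eul, der_sum_apply, Derivation.smul_apply, smul_eq_mul]
  rw [this, Nat.cast_smul_eq_nsmul]

lemma phi_hom (x : Fin n → PolyN n K)
    (hx : ∀ k i, dd φ k (x i) = if i = k then 1 else 0) (hE : φ eul = ∑ i, x i • dd φ i)
    (j : Fin n) (d : ℕ) : ∀ (g : PolyN n K), g.IsHomogeneous d →
    φ (g • (pderiv j : DerN n K)) = aeval x g • dd φ j := by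
  have hEg : ∀ g, (φ eul) (aeval x g) = aeval x ((eul : DerN n K) g) := by
    intro g
    rw [hE]
    simp only [eul, der_sum_apply, intertwine φ x hx, Derivation.smul_apply, smul_eq_mul, map_sum,
      map_mul, aeval_X]
  have hEd : ∀ k, ⁅φ eul, dd φ k⁆ = - dd φ k := by
    intro k
    rw [dd, ← LieEquiv.map_lie, ← lie_skew, lie_pderiv_eul, map_neg]
  induction d with
  | zero =>
    intro g hg
    rw [← totalDegree_zero_iff_isHomogeneous, totalDegree_eq_zero_iff_eq_C] at hg
    rw [hg]
    have : ∀ (c : K) (E : DerN n K), (C c : PolyN n K) • E = c • E := by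
      intro c E; ext p; simp [smul_eq_C_mul]
    rw [aeval_C, algebraMap_eq, this, this, map_smul]
    rfl
  | succ d ih =>
    intro g hg
    have h1 : ∀ k, ⁅dd φ k, φ (g • (pderiv j : DerN n K)) - aeval x g • dd φ j⁆ = 0 := by
      intro k
      rw [der_lie_sub, der_lie_smul, dd_comm, intertwine φ x hx]
      conv_lhs => enter [1]; rw [dd, ← LieEquiv.map_lie, der_lie_smul, pderiv_lie_pderiv]
      rw [smul_zero, add_zero, smul_zero, add_zero, ih _ (by simpa using hg.pderiv), sub_self]
    obtain ⟨c, hc⟩ := dd_centralizer φ _ h1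
    have h2 : ⁅φ eul, φ (g • (pderiv j : DerN n K)) - aeval x g • dd φ j⁆ =
        (d : K) • (φ (g • (pderiv j : DerN n K)) - aeval x g • dd φ j) := by
      have h3 : ⁅(eul : DerN n K), g • (pderiv j : DerN n K)⁆ = (d : K) • (g • (pderiv j : DerN n K)) := by
        rw [der_lie_smul, eul_hom hg, ← lie_skew, lie_pderiv_eul]
        refine Derivation.ext fun p => ?_
        simp [smul_eq_C_mul]
        ring
      rw [der_lie_sub, ← LieEquiv.map_lie, h3, der_lie_smul, hEg, hEd, eul_hom hg, map_smul φ (d : K),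
        map_smul (aeval x) ((d + 1 : ℕ) : K) g]
      refine Derivation.ext fun p => ?_
      simp [smul_eq_C_mul]
      ring
    have h4 : ⁅φ eul, φ (g • (pderiv j : DerN n K)) - aeval x g • dd φ j⁆ =
        - (φ (g • (pderiv j : DerN n K)) - aeval x g • dd φ j) := by
      rw [hc, der_lie_sum, ← Finset.sum_neg_distrib]
      refine Finset.sum_congr rfl fun i _ => ?_
      rw [der_lie_smul_const, hEd, smul_neg]
    rw [h2, ← sub_eq_zero, sub_neg_eq_add] at h4
    have h5 : ((d : K) + 1) • (φ (g • (pderiv j : DerN n K)) - aeval x g • dd φ j) = 0 := by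
      rw [add_smul, one_smul, h4]
    rcases smul_eq_zero.mp h5 with h6 | h6
    · exact absurd h6 (Nat.cast_add_one_ne_zero _)
    · exact sub_eq_zero.mp h6

lemma phi_all (x : Fin n → PolyN n K)
    (hx : ∀ k i, dd φ k (x i) = if i = k then 1 else 0) (hE : φ eul = ∑ i, x i • dd φ i)
    (j : Fin n) (g : PolyN n K) :
    φ (g • (pderiv j : DerN n K)) = aeval x g • dd φ j := by
  induction g using MvPolynomial.induction_on' with
  | monomial u a => exact phi_hom φ x hx hE j _ _ (isHomogeneous_monomial a rfl)
  | add p q hp hq => rw [add_smul, map_add, hp, hq, map_add, add_smul]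

lemma conj_surj (i₀ : Fin n) : ∃ σ : PolyN n K ≃ₐ[K] PolyN n K, conjLie σ = φ := by
  obtain ⟨x, hx, hE⟩ := exists_coords' φ i₀
  have hall := phi_all φ x hx hE
  have hinj : Function.Injective (aeval x : PolyN n K →ₐ[K] PolyN n K) := by
    rw [injective_iff_map_eq_zero]
    intro g hg
    apply der_smul_eq_zero (pderiv_der_ne_zero (K := K) i₀)
    apply lieEquiv_inj φ
    rw [hall, hg, zero_smul, map_zero]
  have hform : ∀ D : DerN n K, φ D = ∑ j, aeval x (D (X j)) • dd φ j := by
    intro D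
    conv_lhs => rw [der_eq_sum D]
    rw [map_sum]
    exact Finset.sum_congr rfl fun j _ => hall j _
  have hsurj : Function.Surjective (aeval x : PolyN n K →ₐ[K] PolyN n K) := by
    intro f
    refine ⟨φ.symm (f • dd φ i₀) (X i₀), ?_⟩
    have h1 := hform (φ.symm (f • dd φ i₀))
    rw [LieEquiv.apply_symm_apply] at h1
    have h2 := congrArg (fun E : DerN n K => E (x i₀)) h1
    simpa [der_sum_apply, hx] using h2.symm
  refine ⟨AlgEquiv.ofBijective (aeval x) ⟨hinj, hsurj⟩, ?_⟩
  set σ := AlgEquiv.ofBijective (aeval x : PolyN n K →ₐ[K] PolyN n K) ⟨hinj, hsurj⟩ with hσ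
  have hs : ∀ g, σ g = aeval x g := fun g => rfl
  refine LieEquiv.ext fun D => Derivation.ext fun p => ?_
  change σ (D (σ.symm p)) = _
  obtain ⟨q, rfl⟩ := σ.surjective p
  rw [AlgEquiv.symm_apply_apply, hform, hs, hs]
  conv_lhs => rw [der_eq_sum D]
  simp only [der_sum_apply, intertwine φ x hx, Derivation.smul_apply, smul_eq_mul, map_sum, map_mul]

end main

/-- The canonical map Aut_K(P_n) → Aut_Lie(D_n), σ ↦ (δ ↦ σδσ⁻¹), is a group
isomorphism: it is bijective and multiplicative. -/
theorem aut_polynomial_iso_aut_lie_derivations (n : ℕ) (K : Type*) [Field K] [CharZero K] :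
    Function.Bijective
      (conjLie : (MvPolynomial (Fin n) K ≃ₐ[K] MvPolynomial (Fin n) K) →
        (Derivation K (MvPolynomial (Fin n) K) (MvPolynomial (Fin n) K) ≃ₗ⁅K⁆
         Derivation K (MvPolynomial (Fin n) K) (MvPolynomial (Fin n) K))) ∧
    ∀ (σ τ : MvPolynomial (Fin n) K ≃ₐ[K] MvPolynomial (Fin n) K)
      (δ : Derivation K (MvPolynomial (Fin n) K) (MvPolynomial (Fin n) K)),
      conjLie (σ * τ) δ = conjLie σ (conjLie τ δ) := by
  rcases Nat.eq_zero_or_pos n with rfl | hn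
  · have hsub : Subsingleton (Derivation K (MvPolynomial (Fin 0) K) (MvPolynomial (Fin 0) K)) :=
      ⟨fun D E => derivation_ext (fun i => i.elim0)⟩
    refine ⟨⟨fun σ τ _ => ?_, fun φ => ⟨1, ?_⟩⟩, fun σ τ δ => Subsingleton.elim _ _⟩
    · apply AlgEquiv.coe_toAlgHom_injective
      apply MvPolynomial.algHom_ext
      exact fun i => i.elim0
    · exact LieEquiv.ext fun D => Subsingleton.elim _ _
  · refine ⟨⟨fun σ τ h => ?_, fun φ => conj_surj φ ⟨0, hn⟩⟩, fun σ τ δ => ?_⟩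
    · ext1 g
      let i : Fin n := ⟨0, hn⟩
      have h1 : conjDer σ (pderiv i) = conjDer τ (pderiv i) := congrArg (fun e => e (pderiv i)) h
      have h2 : conjDer σ (g • pderiv i) = conjDer τ (g • pderiv i) :=
        congrArg (fun e => e (g • pderiv i)) h
      have h3 := congrArg (fun E => E (σ (X i))) h1
      have h4 := congrArg (fun E => E (σ (X i))) h2
      simp only [conjDer_apply, AlgEquiv.symm_apply_apply, pderiv_X_self, map_one,
        Derivation.smul_apply, smul_eq_mul, map_mul, mul_one] at h3 h4
      rw [← h3, mul_one] at h4
      exact h4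
    · ext p
      rfl
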